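/- arXiv:math/0303363 — 3 statements merged into one kernel-verified Lean document; each statement's English description precedes it below -/
import Mathlib

section
/- Let T ∈ (0, ∞), let (n_k)_{k≥1} be a strictly increasing sequence of positive integers with n_k/k → T, and let (R_h)_{h≥1} be a nondecreasing sequence with values in [1, ∞] such that R_{n_k} = ℓ_k for a sequence (ℓ_k) of positive reals. Then liminf_{h→∞} (log R_h)/h = (1/T) liminf_{k→∞} (log ℓ_k)/k and limsup_{h→∞} (log R_h)/h = (1/T) limsup_{k→∞} (log ℓ_k)/k (as equalities of extended reals). -/
open Filter
open scoped ENNReal Topology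

noncomputable section

/-- Logarithm on `[0, ∞]`, with `log ∞ = ∞`, as an extended nonnegative real
(nonpositive logarithms are truncated to `0`). -/
def elog (x : ℝ≥0∞) : ℝ≥0∞ :=
  if x = ⊤ then ⊤ else ENNReal.ofReal (Real.log x.toReal)


lemma aux_lim (v w : ℕ → ℝ≥0∞) (c : ℝ≥0∞) (h0 : c ≠ 0) (ht : c ≠ ⊤)
    (hw : Tendsto w atTop (𝓝 c)) :
    liminf (fun k => w k * v k) atTop = c * liminf v atTop ∧
    limsup (fun k => w k * v k) atTop = c * limsup v atTop := by
  have h1 := hw.limsup_eq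
  have h2 := hw.liminf_eq
  refine ⟨le_antisymm ?_ ?_, le_antisymm ?_ ?_⟩
  · have := ENNReal.liminf_mul_le (f := atTop) (u := w) (v := v) (by simp [h1, h0]) (by simp [h1, ht])
    rw [h1] at this
    exact this
  · have := ENNReal.le_liminf_mul (f := atTop) (u := w) (v := v)
    rw [h2] at this
    exact this
  · have := ENNReal.limsup_mul_le' (f := atTop) (u := w) (v := v) (by simp [h1, h0]) (by simp [h1, ht])
    rw [h1] at this
    exact this
  · have := ENNReal.le_limsup_mul (f := atTop) (u := v) (v := w)
    rw [h2, mul_comm] at this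
    refine this.trans (le_of_eq ?_)
    congr 1
    ext k
    simp [mul_comm]

lemma aux_mono {x y : ℝ≥0∞} (hx : 1 ≤ x) (h : x ≤ y) : elog x ≤ elog y := by
  unfold elog
  by_cases hy : y = ⊤
  · simp [hy]
  · have hx' : x ≠ ⊤ := ne_top_of_le_ne_top hy h
    simp only [hy, hx', if_false]
    apply ENNReal.ofReal_le_ofReal
    apply Real.log_le_log
    · exact ENNReal.toReal_pos (by positivity) hx'
    · exact ENNReal.toReal_mono hy h

/-- **Interpolation of exponential rates along a subsequence.** If `n_k` is a strictly
increasing sequence of positive integers with `n_k / k → T ∈ (0, ∞)` and `(R_h)` is a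
nondecreasing `[1, ∞]`-valued sequence with `R_{n_k} = ℓ_k` for positive reals `ℓ_k`, then
`liminf_h (log R_h)/h = (1/T) liminf_k (log ℓ_k)/k` and similarly for the `limsup`. -/
theorem rate_along_subsequence
    (T : ℝ) (hT : 0 < T)
    (n : ℕ → ℕ) (hmono : StrictMono n) (hpos : ∀ k, 1 ≤ n k)
    (hn : Tendsto (fun k : ℕ => (n k : ℝ) / (k : ℝ)) atTop (𝓝 T))
    (R : ℕ → ℝ≥0∞) (hR1 : ∀ h, 1 ≤ R h) (hRmono : Monotone R)
    (ℓ : ℕ → ℝ) (hℓ : ∀ k, 0 < ℓ k)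
    (hRn : ∀ k, R (n k) = ENNReal.ofReal (ℓ k)) :
    liminf (fun h : ℕ => elog (R h) / (h : ℝ≥0∞)) atTop =
      ENNReal.ofReal (1 / T) *
        liminf (fun k : ℕ => ENNReal.ofReal (Real.log (ℓ k) / (k : ℝ))) atTop ∧
    limsup (fun h : ℕ => elog (R h) / (h : ℝ≥0∞)) atTop =
      ENNReal.ofReal (1 / T) *
        limsup (fun k : ℕ => ENNReal.ofReal (Real.log (ℓ k) / (k : ℝ))) atTop := by
  have hE : Monotone (fun h => elog (R h)) := fun a b hab => aux_mono (hR1 a) (hRmono hab)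
  have hEn : ∀ k, elog (R (n k)) = ENNReal.ofReal (Real.log (ℓ k)) := by
    intro k
    rw [hRn]
    simp [elog, ENNReal.toReal_ofReal (hℓ k).le]
  set v : ℕ → ℝ≥0∞ := fun k => ENNReal.ofReal (Real.log (ℓ k) / (k : ℝ)) with hv
  set u : ℕ → ℝ≥0∞ := fun h => elog (R h) / (h : ℝ≥0∞) with hu
  set c := ENNReal.ofReal (1 / T) with hc
  have hc0 : c ≠ 0 := by simp [hc, hT]
  have hct : c ≠ ⊤ := by simp [hc]
  have hvE : ∀ k, 1 ≤ k → elog (R (n k)) = (k : ℝ≥0∞) * v k := by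
    intro k hk
    have hk' : (0 : ℝ) < k := by exact_mod_cast hk
    rw [hEn, hv]
    simp only
    rw [← ENNReal.ofReal_natCast k, ← ENNReal.ofReal_mul hk'.le]
    congr 1
    field_simp
  have hgen : ∀ p q : ℕ → ℕ, (∀ k, 1 ≤ q k) →
      Tendsto (fun k => (p k : ℝ) / (q k : ℝ)) atTop (𝓝 (1 / T)) →
      Tendsto (fun k => (p k : ℝ≥0∞) / (q k : ℝ≥0∞)) atTop (𝓝 c) := by
    intro p q hq h
    refine (ENNReal.tendsto_ofReal h).congr fun k => ?_
    have : (0 : ℝ) < q k := by exact_mod_cast hq k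
    rw [ENNReal.ofReal_div_of_pos this, ENNReal.ofReal_natCast, ENNReal.ofReal_natCast]
  have r0 : Tendsto (fun k : ℕ => (k : ℝ) / (n k : ℝ)) atTop (𝓝 (1 / T)) := by
    have := hn.inv₀ hT.ne'
    simpa [inv_div] using this
  have hn1 : Tendsto (fun k : ℕ => (n (k+1) : ℝ) / ((k+1 : ℕ) : ℝ)) atTop (𝓝 T) :=
    hn.comp (tendsto_add_atTop_nat 1)
  have r01 : Tendsto (fun k : ℕ => ((k+1 : ℕ) : ℝ) / (n (k+1) : ℝ)) atTop (𝓝 (1 / T)) :=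
    r0.comp (tendsto_add_atTop_nat 1)
  have hone : Tendsto (fun k : ℕ => (k : ℝ) / ((k+1 : ℕ) : ℝ)) atTop (𝓝 1) := by
    simpa using tendsto_natCast_div_add_atTop (1 : ℝ)
  have r1 : Tendsto (fun k : ℕ => ((k+1 : ℕ) : ℝ) / (n k : ℝ)) atTop (𝓝 (1 / T)) := by
    have h := r0.mul (hone.inv₀ one_ne_zero)
    rw [inv_one, mul_one] at h
    refine h.congr' ?_
    filter_upwards [eventually_ge_atTop 1] with k hk
    have hk' : (k : ℝ) ≠ 0 := by positivity
    have : (n k : ℝ) ≠ 0 := by have := hpos k; positivity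
    field_simp
  have r2 : Tendsto (fun k : ℕ => (k : ℝ) / (n (k+1) : ℝ)) atTop (𝓝 (1 / T)) := by
    have h := r01.mul hone
    rw [mul_one] at h
    refine h.congr fun k => ?_
    have : (n (k+1) : ℝ) ≠ 0 := by have := hpos (k+1); positivity
    have h2 : ((k+1 : ℕ) : ℝ) ≠ 0 := by positivity
    field_simp
  obtain ⟨a0, b0⟩ := aux_lim v _ c hc0 hct (hgen (fun k => k) n hpos r0)
  obtain ⟨-, b1⟩ := aux_lim (fun k => v (k+1)) _ c hc0 hct (hgen (fun k => k+1) n hpos r1)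
  obtain ⟨a2, -⟩ := aux_lim v _ c hc0 hct
    (hgen (fun k => k) (fun k => n (k+1)) (fun k => hpos _) r2)
  rw [limsup_nat_add v 1] at b1
  have hun : ∀ᶠ k in atTop, u (n k) = ((k : ℕ) : ℝ≥0∞) / (n k : ℝ≥0∞) * v k := by
    filter_upwards [eventually_ge_atTop 1] with k hk
    simp only [hu]
    rw [hvE k hk]
    simp only [div_eq_mul_inv]
    ring
  have hnt : map n atTop ≤ (atTop : Filter ℕ) := hmono.tendsto_atTop
  let κ : ℕ → ℕ := fun h => Nat.findGreatest (fun k => n k ≤ h) h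
  have hκt : Tendsto κ atTop atTop := by
    rw [tendsto_atTop]
    intro b
    filter_upwards [eventually_ge_atTop (n b)] with h hh
    exact Nat.le_findGreatest ((hmono.id_le b).trans hh) hh
  have hκm : map κ atTop ≤ (atTop : Filter ℕ) := hκt
  have hκ1 : ∀ᶠ h in atTop, n (κ h) ≤ h := by
    filter_upwards [eventually_ge_atTop (n 0)] with h hh
    exact Nat.findGreatest_spec (P := fun k => n k ≤ h) (Nat.zero_le h) hh
  have hκ2 : ∀ h, h ≤ n (κ h + 1) := by
    intro h
    by_contra hcon
    push Not at hcon
    have := Nat.le_findGreatest (P := fun k => n k ≤ h)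
      ((hmono.id_le (κ h + 1)).trans hcon.le) hcon.le
    change κ h + 1 ≤ κ h at this
    omega
  constructor
  · apply le_antisymm
    · rw [← a0, ← liminf_congr hun]
      exact liminf_le_liminf_of_le hnt
    · rw [← a2]
      refine (liminf_le_liminf_of_le hκm).trans ?_
      change liminf (fun h => ((κ h : ℕ) : ℝ≥0∞) / (n (κ h + 1) : ℝ≥0∞) * v (κ h)) atTop ≤ _
      refine liminf_le_liminf ?_
      filter_upwards [hκ1, hκt.eventually_ge_atTop 1] with h h1 h2
      calc ((κ h : ℕ) : ℝ≥0∞) / (n (κ h + 1) : ℝ≥0∞) * v (κ h)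
          = elog (R (n (κ h))) / (n (κ h + 1) : ℝ≥0∞) := by
            rw [hvE _ h2]; simp only [div_eq_mul_inv]; ring
        _ ≤ elog (R h) / (h : ℝ≥0∞) := by
            refine ENNReal.div_le_div (hE h1) ?_
            exact_mod_cast hκ2 h
  · apply le_antisymm
    · rw [← b1]
      refine le_trans ?_ (limsup_le_limsup_of_le hκm)
      change _ ≤ limsup (fun h => ((κ h + 1 : ℕ) : ℝ≥0∞) / (n (κ h) : ℝ≥0∞) * v (κ h + 1)) atTop
      refine limsup_le_limsup ?_
      filter_upwards [hκ1] with h h1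
      calc elog (R h) / (h : ℝ≥0∞)
          ≤ elog (R (n (κ h + 1))) / (n (κ h) : ℝ≥0∞) := by
            refine ENNReal.div_le_div (hE (hκ2 h)) ?_
            exact_mod_cast h1
        _ = ((κ h + 1 : ℕ) : ℝ≥0∞) / (n (κ h) : ℝ≥0∞) * v (κ h + 1) := by
            rw [hvE _ (Nat.le_add_left 1 _)]; simp only [div_eq_mul_inv]; ring
    · rw [← b0, ← limsup_congr hun]
      exact limsup_le_limsup_of_le hnt
end
end

section
/- Let λ > 0 and κ ∈ (0, 1). Let τ : (0, ∞) → ℕ ∪ {∞} be nonincreasing, let (R_k)_{k≥1} be a sequence in ℕ ∪ {∞}, and let (a_k)_{k≥1} be positive reals with (1/k) log a_k → −λ. Suppose that for all sufficiently large k, τ(κ a_k) ≥ R_k ≥ τ(κ^{−1} a_k). Then liminf_{r→0} (log τ(r))/(−log r) = (1/λ) liminf_{k→∞} (log R_k)/k and limsup_{r→0} (log τ(r))/(−log r) = (1/λ) limsup_{k→∞} (log R_k)/k (as equalities of extended reals). -/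
open Filter
open scoped ENNReal Topology

noncomputable section

/-- Logarithm of an extended natural number, as an extended nonnegative real
(`log ∞ = ∞`, nonpositive logarithms are truncated to `0`). -/
def enatLog (n : ℕ∞) : ℝ≥0∞ :=
  if n = ⊤ then ⊤ else ENNReal.ofReal (Real.log (n.toNat : ℝ))

lemma aux_div (p q : ℝ≥0∞) (x y C : ℝ) (hpq : p ≤ q) (hx : 0 < x) (hy : 0 < y)
    (hC : 0 < C) (h : y ≤ C * x) :
    p / ENNReal.ofReal x ≤ ENNReal.ofReal C * (q / ENNReal.ofReal y) := by
  rw [div_eq_mul_inv, div_eq_mul_inv, ← ENNReal.ofReal_inv_of_pos hx,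
    ← ENNReal.ofReal_inv_of_pos hy, mul_left_comm, ← ENNReal.ofReal_mul hC.le]
  gcongr
  rw [← div_eq_mul_inv, inv_eq_one_div, div_le_div_iff₀ hx hy]
  linarith

lemma aux_liminf {α β : Type} {l : Filter α} {m : Filter β} (u : α → ℝ≥0∞) (v : β → ℝ≥0∞)
    (φ : α → β) (hφ : Tendsto φ l m) (C : ℝ) (h : ∀ᶠ x in l, v (φ x) ≤ ENNReal.ofReal C * u x)
    (hC : 0 < C) :
    liminf v m ≤ ENNReal.ofReal C * liminf u l := by
  have h0 : ENNReal.ofReal C ≠ 0 := by simpa using hC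
  calc liminf v m ≤ liminf v (map φ l) := liminf_le_liminf_of_le hφ
    _ = liminf (v ∘ φ) l := rfl
    _ ≤ liminf (fun x => ENNReal.ofReal C * u x) l := liminf_le_liminf h
    _ = _ := by
      have := (OrderIso.liminf_apply (f := l) (u := u)
        (ENNReal.mulLeftOrderIso (ENNReal.ofReal C) (by simp [ENNReal.isUnit_iff, h0])))
      simpa using this.symm

lemma aux_limsup {α β : Type} {l : Filter α} {m : Filter β} (u : α → ℝ≥0∞) (v : β → ℝ≥0∞)
    (φ : α → β) (hφ : Tendsto φ l m) (C : ℝ) (h : ∀ᶠ x in l, u x ≤ ENNReal.ofReal C * v (φ x)) :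
    limsup u l ≤ ENNReal.ofReal C * limsup v m := by
  calc limsup u l ≤ limsup (fun x => ENNReal.ofReal C * v (φ x)) l := limsup_le_limsup h
    _ = ENNReal.ofReal C * limsup (v ∘ φ) l :=
        ENNReal.limsup_const_mul_of_ne_top ENNReal.ofReal_ne_top
    _ ≤ _ := by
      gcongr
      exact limsup_le_limsup_of_le (f := map φ l) hφ

lemma aux_one (A B : ℝ≥0∞) (h : ∀ c : ℝ, 1 < c → A ≤ ENNReal.ofReal (c ^ 2) * B) : A ≤ B := by
  have h1 : Tendsto (fun c : ℝ => ENNReal.ofReal (c ^ 2) * B) (𝓝[>] 1) (𝓝 (1 * B)) := by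
    apply ENNReal.Tendsto.mul_const _ (Or.inl one_ne_zero)
    have : Tendsto (fun c : ℝ => ENNReal.ofReal (c ^ 2)) (𝓝 1) (𝓝 (ENNReal.ofReal (1 ^ 2))) :=
      (ENNReal.continuous_ofReal.comp (continuous_pow 2)).tendsto 1
    simp only [one_pow, ENNReal.ofReal_one] at this
    exact this.mono_left nhdsWithin_le_nhds
  rw [one_mul] at h1
  exact ge_of_tendsto h1 (eventually_nhdsWithin_of_forall fun c hc => h c hc)

lemma aux_core (F : ℝ → ℝ≥0∞) (hF : Monotone F) (g : ℕ → ℝ≥0∞)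
    (h : ∀ c : ℝ, 1 < c → ∀ᶠ k : ℕ in atTop, F (k / c) ≤ g k ∧ g k ≤ F (c * k)) :
    liminf (fun x : ℝ => F x / ENNReal.ofReal x) atTop =
      liminf (fun k : ℕ => g k / (k : ℝ≥0∞)) atTop ∧
    limsup (fun x : ℝ => F x / ENNReal.ofReal x) atTop =
      limsup (fun k : ℕ => g k / (k : ℝ≥0∞)) atTop := by
  have key1 : ∀ c : ℝ, 1 < c → ∀ᶠ x : ℝ in atTop, F x / ENNReal.ofReal x ≤
      ENNReal.ofReal (c ^ 2) * (g ⌈c * x⌉₊ / ((⌈c * x⌉₊ : ℕ) : ℝ≥0∞)) := by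
    intro c hc
    have hc0 : 0 < c := by linarith
    have ht : Tendsto (fun x : ℝ => ⌈c * x⌉₊) atTop atTop :=
      tendsto_nat_ceil_atTop.comp (tendsto_id.const_mul_atTop hc0)
    have hcc : 0 < c ^ 2 - c := by nlinarith
    filter_upwards [ht.eventually (h c hc), eventually_gt_atTop 0,
      eventually_ge_atTop (1 / (c ^ 2 - c))] with x hk hx hx2
    rw [div_le_iff₀ hcc] at hx2
    have h1 := Nat.le_ceil (c * x)
    have h2 := Nat.ceil_lt_add_one (mul_pos hc0 hx).le
    rw [← ENNReal.ofReal_natCast]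
    refine aux_div _ _ _ _ _ ((hF ?_).trans hk.1) hx (lt_of_lt_of_le (mul_pos hc0 hx) h1)
      (by positivity) (by nlinarith)
    rw [le_div_iff₀ hc0]; linarith
  have key2 : ∀ c : ℝ, 1 < c → ∀ᶠ x : ℝ in atTop,
      (g ⌊x / c⌋₊ / ((⌊x / c⌋₊ : ℕ) : ℝ≥0∞)) ≤
      ENNReal.ofReal (c ^ 2) * (F x / ENNReal.ofReal x) := by
    intro c hc
    have hc0 : 0 < c := by linarith
    have ht : Tendsto (fun x : ℝ => ⌊x / c⌋₊) atTop atTop :=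
      tendsto_nat_floor_atTop.comp (tendsto_id.atTop_div_const hc0)
    have hcc : 0 < c - 1 := by linarith
    filter_upwards [ht.eventually (h c hc), eventually_gt_atTop 0,
      eventually_ge_atTop (c ^ 2 / (c - 1)), ht.eventually (eventually_gt_atTop 0)]
      with x hk hx hx2 h0
    rw [div_le_iff₀ hcc] at hx2
    have h1 := Nat.floor_le (div_pos hx hc0).le
    have h2 := Nat.lt_floor_add_one (x / c)
    rw [le_div_iff₀ hc0] at h1
    rw [div_lt_iff₀ hc0] at h2
    rw [← ENNReal.ofReal_natCast]
    refine aux_div _ _ _ _ _ (hk.2.trans (hF ?_)) (by exact_mod_cast h0) hx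
      (by positivity) ?_
    · linarith
    · nlinarith
  have key3 : ∀ c : ℝ, 1 < c → ∀ᶠ k : ℕ in atTop, F (k / c) / ENNReal.ofReal (k / c) ≤
      ENNReal.ofReal (c ^ 2) * (g k / (k : ℝ≥0∞)) := by
    intro c hc
    have hc0 : 0 < c := by linarith
    filter_upwards [h c hc, eventually_gt_atTop 0] with k hk h0
    have h0' : (0 : ℝ) < k := by exact_mod_cast h0
    rw [← ENNReal.ofReal_natCast]
    refine aux_div _ _ _ _ _ hk.1 (by positivity) h0' (by positivity) ?_
    have : c ^ 2 * (k / c) = c * k := by field_simp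
    rw [this]; nlinarith
  have key4 : ∀ c : ℝ, 1 < c → ∀ᶠ k : ℕ in atTop, g k / (k : ℝ≥0∞) ≤
      ENNReal.ofReal (c ^ 2) * (F (c * k) / ENNReal.ofReal (c * k)) := by
    intro c hc
    have hc0 : 0 < c := by linarith
    filter_upwards [h c hc, eventually_gt_atTop 0] with k hk h0
    have h0' : (0 : ℝ) < k := by exact_mod_cast h0
    rw [← ENNReal.ofReal_natCast]
    refine aux_div _ _ _ _ _ hk.2 h0' (by positivity) (by positivity) ?_
    have : c ≤ c ^ 2 := by nlinarith
    gcongr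
  refine ⟨le_antisymm ?_ ?_, le_antisymm ?_ ?_⟩ <;> refine aux_one _ _ fun c hc => ?_ <;>
    have hc0 : 0 < c := by linarith
  · exact aux_liminf _ (fun x : ℝ => F x / ENNReal.ofReal x) (fun k : ℕ => (k : ℝ) / c)
      (tendsto_natCast_atTop_atTop.atTop_div_const hc0) _ (key3 c hc) (by positivity)
  · exact aux_liminf _ (fun k : ℕ => g k / (k : ℝ≥0∞)) (fun x : ℝ => ⌊x / c⌋₊)
      (tendsto_nat_floor_atTop.comp (tendsto_id.atTop_div_const hc0)) _ (key2 c hc)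
      (by positivity)
  · exact aux_limsup _ (fun k : ℕ => g k / (k : ℝ≥0∞)) (fun x : ℝ => ⌈c * x⌉₊)
      (tendsto_nat_ceil_atTop.comp (tendsto_id.const_mul_atTop hc0)) _ (key1 c hc)
  · exact aux_limsup _ (fun x : ℝ => F x / ENNReal.ofReal x) (fun k : ℕ => c * (k : ℝ))
      (tendsto_natCast_atTop_atTop.const_mul_atTop hc0) _ (key4 c hc)

lemma aux_enatLog_mono : Monotone enatLog := by
  intro m n h
  unfold enatLog
  split_ifs with h1 h2 h2
  · exact le_rfl
  · subst h1; exact absurd (top_le_iff.1 h) h2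
  · exact le_top
  · apply ENNReal.ofReal_le_ofReal
    have h3 : m.toNat ≤ n.toNat := ENat.toNat_le_toNat h h2
    rcases Nat.eq_zero_or_pos m.toNat with h0 | h0
    · rw [h0]; simp; exact Real.log_natCast_nonneg _
    · exact Real.log_le_log (by exact_mod_cast h0) (by exact_mod_cast h3)

/-- **From repetition times to return times.** Let `λ > 0`, `κ ∈ (0,1)`, `τ` a nonincreasing
`(0,∞) → ℕ ∪ {∞}` function, `(R_k)` a sequence in `ℕ ∪ {∞}` and `(a_k)` positive reals with
`(1/k) log a_k → -λ`. If eventually `τ(κ a_k) ≥ R_k ≥ τ(κ⁻¹ a_k)`, then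
`liminf_{r→0} (log τ(r))/(-log r) = (1/λ) liminf_k (log R_k)/k`, and similarly for `limsup`. -/
theorem recurrence_rate_eq_repetition_rate
    (lam κ : ℝ) (hlam : 0 < lam) (hκ0 : 0 < κ) (hκ1 : κ < 1)
    (τ : ℝ → ℕ∞) (hτ : ∀ r r' : ℝ, 0 < r → r ≤ r' → τ r' ≤ τ r)
    (R : ℕ → ℕ∞) (a : ℕ → ℝ) (ha : ∀ k, 0 < a k)
    (halim : Tendsto (fun k : ℕ => Real.log (a k) / (k : ℝ)) atTop (𝓝 (-lam)))
    (hsq : ∃ K : ℕ, ∀ k, K ≤ k → τ (κ⁻¹ * a k) ≤ R k ∧ R k ≤ τ (κ * a k)) :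
    liminf (fun r : ℝ => enatLog (τ r) / ENNReal.ofReal (-Real.log r)) (𝓝[>] 0) =
      ENNReal.ofReal (1 / lam) *
        liminf (fun k : ℕ => enatLog (R k) / (k : ℝ≥0∞)) atTop ∧
    limsup (fun r : ℝ => enatLog (τ r) / ENNReal.ofReal (-Real.log r)) (𝓝[>] 0) =
      ENNReal.ofReal (1 / lam) *
        limsup (fun k : ℕ => enatLog (R k) / (k : ℝ≥0∞)) atTop := by
  set F : ℝ → ℝ≥0∞ := fun x => enatLog (τ (Real.exp (-(lam * x)))) with hFdef
  have hF : Monotone F := by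
    intro x y hxy
    apply aux_enatLog_mono
    apply hτ _ _ (Real.exp_pos _)
    apply Real.exp_le_exp.2
    have := mul_le_mul_of_nonneg_left hxy hlam.le
    linarith
  obtain ⟨K, hK⟩ := hsq
  have hlk : Real.log κ < 0 := Real.log_neg hκ0 hκ1
  have hdiv : Tendsto (fun k : ℕ => Real.log κ / (k : ℝ)) atTop (𝓝 0) :=
    tendsto_const_div_atTop_nhds_zero_nat _
  have hcore := aux_core F hF (fun k => enatLog (R k)) (by
    intro c hc
    have hc0 : 0 < c := by linarith
    have t1 := halim.sub hdiv
    have t2 := halim.add hdiv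
    rw [sub_zero] at t1
    rw [add_zero] at t2
    have e1 : -lam < -(lam / c) := by
      have : lam / c < lam := div_lt_self hlam hc
      linarith
    have e2 : -(lam * c) < -lam := by nlinarith
    filter_upwards [eventually_ge_atTop K, eventually_gt_atTop 0,
      t1.eventually (gt_mem_nhds e1), t2.eventually (lt_mem_nhds e2)] with k hk h0 q1 q2
    have h0' : (0 : ℝ) < k := by exact_mod_cast h0
    obtain ⟨s1, s2⟩ := hK k hk
    rw [← sub_div, div_lt_iff₀ h0'] at q1
    rw [← add_div, lt_div_iff₀ h0'] at q2
    constructor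
    · refine aux_enatLog_mono (le_trans (hτ _ _ (mul_pos (inv_pos.2 hκ0) (ha k)) ?_) s1)
      rw [← Real.log_le_iff_le_exp (mul_pos (inv_pos.2 hκ0) (ha k)),
        Real.log_mul (inv_pos.2 hκ0).ne' (ha k).ne', Real.log_inv]
      have : -(lam * (k / c)) = -(lam / c) * k := by ring
      linarith
    · refine aux_enatLog_mono (le_trans s2 (hτ _ _ (Real.exp_pos _) ?_))
      rw [← Real.le_log_iff_exp_le (mul_pos hκ0 (ha k)),
        Real.log_mul hκ0.ne' (ha k).ne']
      have : -(lam * (c * k)) = -(lam * c) * k := by ring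
      linarith)
  have hl0 : 0 < 1 / lam := by positivity
  have hmap1 : Tendsto (fun x : ℝ => Real.exp (-(lam * x))) atTop (𝓝[>] 0) :=
    Real.tendsto_exp_atBot_nhdsGT.comp
      (tendsto_neg_atTop_atBot.comp (tendsto_id.const_mul_atTop hlam))
  have hmap2 : Tendsto (fun r : ℝ => -Real.log r / lam) (𝓝[>] 0) atTop :=
    (tendsto_neg_atBot_atTop.comp Real.tendsto_log_nhdsGT_zero).atTop_div_const hlam
  have hev1 : ∀ᶠ x : ℝ in atTop, enatLog (τ (Real.exp (-(lam * x)))) /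
      ENNReal.ofReal (-Real.log (Real.exp (-(lam * x)))) =
      ENNReal.ofReal (1 / lam) * (F x / ENNReal.ofReal x) := by
    filter_upwards [eventually_gt_atTop 0] with x hx
    rw [Real.log_exp, neg_neg, ENNReal.div_eq_inv_mul, ENNReal.div_eq_inv_mul,
      ← ENNReal.ofReal_inv_of_pos hx, ← ENNReal.ofReal_inv_of_pos (mul_pos hlam hx),
      ← mul_assoc, ← ENNReal.ofReal_mul hl0.le]
    congr 2
    field_simp
  have hmap : map (fun x : ℝ => Real.exp (-(lam * x))) atTop = 𝓝[>] (0 : ℝ) := by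
    apply le_antisymm hmap1
    have : map (fun x : ℝ => Real.exp (-(lam * x))) (map (fun r : ℝ => -Real.log r / lam) (𝓝[>] 0))
        = 𝓝[>] 0 := by
      rw [map_map]
      conv_rhs => rw [← map_id (f := 𝓝[>] (0 : ℝ))]
      apply Filter.map_congr
      filter_upwards [self_mem_nhdsWithin] with r hr
      have hr' : 0 < r := hr
      have e : -(lam * (-Real.log r / lam)) = Real.log r := by field_simp
      simp only [Function.comp, id]
      rw [e, Real.exp_log hr']
    exact this.symm.le.trans (map_mono hmap2)
  constructor
  · rw [← hcore.1, ← hmap, ← liminf_comp]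
    refine Eq.trans (liminf_congr hev1) ?_
    exact ENNReal.liminf_const_mul_of_ne_top ENNReal.ofReal_ne_top
  · rw [← hcore.2, ← hmap, ← limsup_comp]
    refine Eq.trans (limsup_congr hev1) ?_
    exact ENNReal.limsup_const_mul_of_ne_top ENNReal.ofReal_ne_top
end
end

section
/- For any extended reals 0 ≤ a ≤ b ≤ ∞ there exists a sequence (ℓ_n)_{n≥1} of positive integers such that: (i) there is n₀ with ℓ_{n+1} ≥ ℓ_n + 2n for all n ≥ n₀; (ii) ℓ_n/n² → ∞; (iii) liminf_{n→∞} (log ℓ_n)/n = a and limsup_{n→∞} (log ℓ_n)/n = b. -/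
open Filter
open scoped ENNReal Topology

noncomputable def rateF (x : ℝ≥0∞) (n : ℕ) : ℝ := n * (min x (n : ℝ≥0∞)).toReal + √(n : ℝ)

lemma rateF_min_ne_top (x : ℝ≥0∞) (n : ℕ) : min x (n : ℝ≥0∞) ≠ ⊤ :=
  ne_top_of_le_ne_top (ENNReal.natCast_ne_top n) (min_le_right _ _)

lemma rateF_mono (x : ℝ≥0∞) : Monotone (rateF x) := by
  intro m n h
  unfold rateF
  have h1 : (m : ℝ) ≤ n := by exact_mod_cast h
  have h2 : (m : ℝ≥0∞) ≤ n := by exact_mod_cast h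
  have h3 := ENNReal.toReal_mono (rateF_min_ne_top x n) (min_le_min (le_refl x) h2)
  have h4 := Real.sqrt_le_sqrt h1
  gcongr

lemma rateF_le {x y : ℝ≥0∞} (h : x ≤ y) (n : ℕ) : rateF x n ≤ rateF y n := by
  unfold rateF
  have h3 := ENNReal.toReal_mono (rateF_min_ne_top y n) (min_le_min h (le_refl (n : ℝ≥0∞)))
  gcongr

lemma sqrt_le_rateF (x : ℝ≥0∞) (n : ℕ) : √(n : ℝ) ≤ rateF x n := by
  unfold rateF
  have : 0 ≤ (n : ℝ) * (min x (n : ℝ≥0∞)).toReal := by positivity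
  linarith

lemma tendsto_sqrt_natCast : Tendsto (fun n : ℕ => √(n : ℝ)) atTop atTop :=
  Real.tendsto_sqrt_atTop.comp tendsto_natCast_atTop_atTop

lemma rateF_tendsto (x : ℝ≥0∞) (c d : ℝ) (hc : 0 ≤ c) (hd : 0 ≤ d) :
    Tendsto (fun n : ℕ => ENNReal.ofReal ((rateF x n + (c * √(n : ℝ) + d)) / (n : ℝ)))
      atTop (𝓝 x) := by
  have h1 : Tendsto (fun n : ℕ => min x (n : ℝ≥0∞)) atTop (𝓝 x) := by
    have := (tendsto_const_nhds (x := x)).min ENNReal.tendsto_nat_nhds_top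
    simpa using this
  have h2 : Tendsto (fun n : ℕ => (c + 1) * (√(n : ℝ))⁻¹ + d * ((n : ℝ))⁻¹) atTop (𝓝 0) := by
    have e1 := (tendsto_inv_atTop_zero.comp tendsto_sqrt_natCast).const_mul (c + 1)
    have e2 := (tendsto_inv_atTop_zero.comp
      (tendsto_natCast_atTop_atTop (R := ℝ))).const_mul d
    simpa using e1.add e2
  have h3 := h1.add (ENNReal.tendsto_ofReal h2)
  rw [ENNReal.ofReal_zero, add_zero] at h3
  refine h3.congr' ?_
  filter_upwards [eventually_ge_atTop 1] with n hn
  have hn' : (0 : ℝ) < n := by exact_mod_cast hn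
  have hs : 0 < √(n : ℝ) := Real.sqrt_pos.2 hn'
  have hss : √(n : ℝ) * √(n : ℝ) = n := Real.mul_self_sqrt hn'.le
  have key : (rateF x n + (c * √(n : ℝ) + d)) / (n : ℝ)
      = (min x (n : ℝ≥0∞)).toReal + ((c + 1) * (√(n : ℝ))⁻¹ + d * ((n : ℝ))⁻¹) := by
    unfold rateF
    have : (√(n : ℝ))⁻¹ = √(n : ℝ) / n := by
      rw [inv_eq_one_div, div_eq_div_iff hs.ne' hn'.ne']; linarith
    rw [this]
    field_simp
    ring
  rw [key, ENNReal.ofReal_add ENNReal.toReal_nonneg (by positivity),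
    ENNReal.ofReal_toReal (rateF_min_ne_top x n)]

open Classical in
noncomputable def stepS (A B : ℕ → ℝ) : ℕ → ℕ
  | 0 => 0
  | n + 1 => if B (stepS A B n) ≤ A n then n + 1 else stepS A B n

lemma stepS_le (A B : ℕ → ℝ) (n : ℕ) : stepS A B n ≤ n := by
  induction n with
  | zero => simp [stepS]
  | succ n ih => rw [stepS]; split_ifs <;> omega

lemma stepS_mono (A B : ℕ → ℝ) : Monotone (stepS A B) := by
  refine monotone_nat_of_le_succ fun n => ?_
  have := stepS_le A B n
  rw [stepS]; split_ifs <;> omega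

lemma stepS_freq (A B : ℕ → ℝ) (hA : Tendsto A atTop atTop) :
    ∃ᶠ n in atTop, B (stepS A B n) ≤ A n := by
  intro h
  obtain ⟨N, hN⟩ := eventually_atTop.1 h
  have hc : ∀ n, N ≤ n → stepS A B n = stepS A B N := by
    intro n hn
    induction n, hn using Nat.le_induction with
    | base => rfl
    | succ n hn ih => rw [stepS, if_neg (hN n hn), ih]
  obtain ⟨n, hn1, hn2⟩ :=
    ((hA.eventually_ge_atTop (B (stepS A B N))).and (eventually_ge_atTop N)).exists
  apply hN n hn2
  rw [hc n hn2]; exact hn1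

lemma stepS_freq_eq (A B : ℕ → ℝ) (hA : Tendsto A atTop atTop) :
    ∃ᶠ n in atTop, stepS A B n = n := by
  rw [frequently_atTop]
  intro N
  obtain ⟨n, hn, h⟩ := frequently_atTop.1 (stepS_freq A B hA) N
  exact ⟨n + 1, by omega, by rw [stepS, if_pos h]⟩

lemma liminf_le_of_freq {u v : ℕ → ℝ≥0∞} {a : ℝ≥0∞} (h : ∃ᶠ n in atTop, u n ≤ v n)
    (hv : Tendsto v atTop (𝓝 a)) : liminf u atTop ≤ a := by
  refine le_of_forall_gt_imp_ge_of_dense fun c hc => ?_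
  refine liminf_le_of_frequently_le' ?_
  exact (h.and_eventually (hv.eventually_lt_const hc)).mono fun n hn => hn.1.trans hn.2.le

lemma le_limsup_of_freq {u v : ℕ → ℝ≥0∞} {a : ℝ≥0∞} (h : ∃ᶠ n in atTop, v n ≤ u n)
    (hv : Tendsto v atTop (𝓝 a)) : a ≤ limsup u atTop := by
  refine le_of_forall_lt_imp_le_of_dense fun c hc => ?_
  refine le_limsup_of_frequently_le' ?_
  exact (h.and_eventually (hv.eventually_const_lt hc)).mono fun n hn => hn.2.le.trans hn.1

lemma log_bound (n : ℕ) (g : ℝ) (hg : 0 ≤ g) :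
    g ≤ Real.log ((n ^ 3 + ⌈Real.exp g⌉₊ : ℕ) : ℝ) ∧
    Real.log ((n ^ 3 + ⌈Real.exp g⌉₊ : ℕ) : ℝ) ≤ g + (6 * √(n : ℝ) + 12) := by
  have h1 := Nat.le_ceil (Real.exp g)
  have h2 := Nat.ceil_lt_add_one (Real.exp_pos g).le
  have he : 1 ≤ Real.exp g := Real.one_le_exp hg
  have hn : (0 : ℝ) ≤ n := Nat.cast_nonneg n
  have hn3 : (0 : ℝ) ≤ (n : ℝ) ^ 3 := by positivity
  push_cast
  constructor
  · rw [Real.le_log_iff_exp_le (by linarith)]; linarith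
  · have h3 : (n : ℝ) ^ 3 + ⌈Real.exp g⌉₊ ≤ ((n : ℝ) + 2) ^ 3 * Real.exp g := by
      have : (n : ℝ) ^ 3 + 2 ≤ ((n : ℝ) + 2) ^ 3 := by nlinarith [sq_nonneg (n : ℝ)]
      nlinarith
    have h4 := Real.log_le_log (by linarith) h3
    rw [Real.log_mul (by positivity) (by positivity), Real.log_exp, Real.log_pow] at h4
    have h5 : Real.log ((n : ℝ) + 2) ≤ 2 * √((n : ℝ) + 2) := by
      have h6 := Real.log_le_self (Real.sqrt_nonneg ((n : ℝ) + 2))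
      rw [Real.log_sqrt (by positivity)] at h6
      linarith
    have h7 : √((n : ℝ) + 2) ≤ √(n : ℝ) + 2 := by
      rw [Real.sqrt_le_left (by positivity)]
      nlinarith [Real.sq_sqrt hn, Real.sqrt_nonneg (n : ℝ)]
    push_cast at h4
    linarith

/-- **Existence of sequences with prescribed exponential rates.** For any extended reals
`0 ≤ a ≤ b ≤ ∞` there is a sequence `(ℓ_n)` of positive integers with `ℓ_{n+1} ≥ ℓ_n + 2n`
eventually, `ℓ_n / n² → ∞`, `liminf (log ℓ_n)/n = a` and `limsup (log ℓ_n)/n = b`. -/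
theorem exists_sequence_with_prescribed_log_rates (a b : ℝ≥0∞) (hab : a ≤ b) :
    ∃ ℓ : ℕ → ℕ,
      (∀ n, 1 ≤ ℓ n) ∧
      (∃ n₀ : ℕ, ∀ n, n₀ ≤ n → ℓ n + 2 * n ≤ ℓ (n + 1)) ∧
      Tendsto (fun n : ℕ => (ℓ n : ℝ) / (n : ℝ) ^ 2) atTop atTop ∧
      liminf (fun n : ℕ => ENNReal.ofReal (Real.log (ℓ n) / (n : ℝ))) atTop = a ∧
      limsup (fun n : ℕ => ENNReal.ofReal (Real.log (ℓ n) / (n : ℝ))) atTop = b := by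
  set A := rateF a with hAdef
  set B := rateF b with hBdef
  have hA : Tendsto A atTop atTop := tendsto_atTop_mono (sqrt_le_rateF a) tendsto_sqrt_natCast
  let s := stepS A B
  let g : ℕ → ℝ := fun n => max (A n) (B (s n))
  have hAg : ∀ n, A n ≤ g n := fun n => le_max_left _ _
  have hgB : ∀ n, g n ≤ B n := fun n =>
    max_le (rateF_le hab n) (rateF_mono b (stepS_le A B n))
  have hg0 : ∀ n, 0 ≤ g n := fun n =>
    ((Real.sqrt_nonneg _).trans (sqrt_le_rateF a n)).trans (hAg n)
  have hgm : Monotone g := fun m n h =>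
    max_le_max (rateF_mono a h) (rateF_mono b (stepS_mono A B h))
  have hfa : ∃ᶠ n in atTop, g n = A n :=
    (stepS_freq A B hA).mono fun n hn => max_eq_left hn
  have hfb : ∃ᶠ n in atTop, g n = B n :=
    (stepS_freq_eq A B hA).mono fun n hn =>
      le_antisymm (hgB n) (by
        have : B (s n) ≤ g n := le_max_right _ _
        have e : s n = n := hn
        rwa [e] at this)
  have hlow : ∀ x : ℝ≥0∞,
      Tendsto (fun n : ℕ => ENNReal.ofReal (rateF x n / (n : ℝ))) atTop (𝓝 x) := fun x => by
    simpa using rateF_tendsto x 0 0 le_rfl le_rfl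
  have hup : ∀ x : ℝ≥0∞,
      Tendsto (fun n : ℕ => ENNReal.ofReal ((rateF x n + (6 * √(n : ℝ) + 12)) / (n : ℝ)))
      atTop (𝓝 x) := fun x => rateF_tendsto x 6 12 (by norm_num) (by norm_num)
  have lb : ∀ n, g n ≤ Real.log ((n ^ 3 + ⌈Real.exp (g n)⌉₊ : ℕ) : ℝ) :=
    fun n => (log_bound n (g n) (hg0 n)).1
  have ub : ∀ n, Real.log ((n ^ 3 + ⌈Real.exp (g n)⌉₊ : ℕ) : ℝ) ≤ g n + (6 * √(n : ℝ) + 12) :=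
    fun n => (log_bound n (g n) (hg0 n)).2
  refine ⟨fun n => n ^ 3 + ⌈Real.exp (g n)⌉₊, ?_, ⟨0, ?_⟩, ?_, ?_, ?_⟩
  · intro n
    have : 0 < ⌈Real.exp (g n)⌉₊ := Nat.ceil_pos.2 (Real.exp_pos _)
    show 1 ≤ n ^ 3 + ⌈Real.exp (g n)⌉₊
    omega
  · intro n _
    have h1 : ⌈Real.exp (g n)⌉₊ ≤ ⌈Real.exp (g (n + 1))⌉₊ :=
      Nat.ceil_mono (Real.exp_le_exp.2 (hgm (Nat.le_succ n)))
    have h2 : n ^ 3 + 2 * n ≤ (n + 1) ^ 3 := by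
      ring_nf; nlinarith
    show n ^ 3 + ⌈Real.exp (g n)⌉₊ + 2 * n ≤ (n + 1) ^ 3 + ⌈Real.exp (g (n + 1))⌉₊
    omega
  · refine tendsto_atTop_mono' _ ?_ (tendsto_natCast_atTop_atTop (R := ℝ))
    filter_upwards [eventually_ge_atTop 1] with n hn
    have hn' : (0 : ℝ) < n := by exact_mod_cast hn
    rw [le_div_iff₀ (by positivity)]
    push_cast
    have : (0 : ℝ) ≤ ⌈Real.exp (g n)⌉₊ := Nat.cast_nonneg _
    nlinarith
  · apply le_antisymm
    · refine liminf_le_of_freq (hfa.mono fun n hn => ?_) (hup a)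
      have := ub n
      rw [hn] at this
      beta_reduce
      rw [hn]
      gcongr
    · rw [← (hlow a).liminf_eq]
      refine liminf_le_liminf (Eventually.of_forall fun n => ?_)
      have := (hAg n).trans (lb n)
      show ENNReal.ofReal (A n / n) ≤ ENNReal.ofReal (Real.log _ / n)
      gcongr
  · apply le_antisymm
    · rw [← (hup b).limsup_eq]
      refine limsup_le_limsup (Eventually.of_forall fun n => ?_)
      have h1 := ub n
      have h2 := hgB n
      have h3 := h1.trans (add_le_add_left h2 (6 * √(n : ℝ) + 12))
      show ENNReal.ofReal (Real.log _ / n) ≤ ENNReal.ofReal ((B n + (6 * √(n : ℝ) + 12)) / n)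
      gcongr
    · refine le_limsup_of_freq (hfb.mono fun n hn => ?_) (hlow b)
      have := lb n
      rw [hn] at this
      beta_reduce
      rw [hn]
      gcongr
end
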